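/- arXiv:0802.1077 — 8 statements merged into one kernel-verified Lean document; each statement's English description precedes it below -/
import Mathlib

section
/- Let f : ℂ → ℂ^N be differentiable (holomorphic) with f(ξ) ≠ 0 for all ξ, and define the rank-one projector P₀(ξ) := (f(ξ) ⊗ f(ξ)†)/(f(ξ)† · f(ξ)). Then at every point ξ the Wirtinger derivative ∂P₀(ξ) satisfies P₀(ξ) * ∂P₀(ξ) = 0 and ∂P₀(ξ) * P₀(ξ) = ∂P₀(ξ); in particular the commutator [∂P₀, P₀](ξ) = ∂P₀(ξ) * P₀(ξ) - P₀(ξ) * ∂P₀(ξ) equals ∂P₀(ξ). -/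
open Matrix Complex

attribute [local instance] Matrix.normedAddCommGroup Matrix.normedSpace

/-- Wirtinger derivative ∂u. -/
noncomputable def wirtingerD {E : Type*} [NormedAddCommGroup E] [NormedSpace ℂ E]
    (u : ℂ → E) (z : ℂ) : E :=
  (2 : ℂ)⁻¹ • (fderiv ℝ u z 1 - Complex.I • fderiv ℝ u z Complex.I)

/-- Wirtinger derivative ∂̄u. -/
noncomputable def wirtingerDBar {E : Type*} [NormedAddCommGroup E] [NormedSpace ℂ E]
    (u : ℂ → E) (z : ℂ) : E :=
  (2 : ℂ)⁻¹ • (fderiv ℝ u z 1 + Complex.I • fderiv ℝ u z Complex.I)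

/-- The rank-one projector P₀ = (f ⊗ f†)/(f† · f). -/
noncomputable def proj0 {N : ℕ} (f : ℂ → Fin N → ℂ) (ξ : ℂ) :
    Matrix (Fin N) (Fin N) ℂ :=
  fun j k => f ξ j * (starRingEnd ℂ) (f ξ k) /
    (∑ l, (starRingEnd ℂ) (f ξ l) * f ξ l)

theorem wirtingerD_mul {u v : ℂ → ℂ} {z : ℂ} (hu : DifferentiableAt ℝ u z)
    (hv : DifferentiableAt ℝ v z) :
    wirtingerD (fun w => u w * v w) z = wirtingerD u z * v z + u z * wirtingerD v z := by
  simp only [wirtingerD, fderiv_fun_mul hu hv, _root_.add_apply, _root_.smul_apply, smul_eq_mul]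
  ring

theorem wirtingerD_smul_const {E : Type*} [NormedAddCommGroup E] [NormedSpace ℂ E] {u : ℂ → ℂ}
    {z : ℂ} (hu : DifferentiableAt ℝ u z) (e : E) :
    wirtingerD (fun w => u w • e) z = wirtingerD u z • e := by
  simp only [wirtingerD, fderiv_smul_const hu, ContinuousLinearMap.smulRight_apply, sub_smul,
    smul_assoc]

theorem wirtingerD_sum {ι E : Type*} [NormedAddCommGroup E] [NormedSpace ℂ E] {s : Finset ι}
    {u : ι → ℂ → E} {z : ℂ}
    (hu : ∀ i ∈ s, DifferentiableAt ℝ (u i) z) :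
    wirtingerD (fun w => ∑ i ∈ s, u i w) z = ∑ i ∈ s, wirtingerD (u i) z := by
  simp only [wirtingerD, fderiv_fun_sum hu, _root_.sum_apply, Finset.smul_sum,
    ← Finset.sum_sub_distrib]

theorem wirtingerD_eq_deriv {u : ℂ → ℂ} {z : ℂ} (hu : DifferentiableAt ℂ u z) :
    wirtingerD u z = deriv u z := by
  have h := hu.hasDerivAt.hasFDerivAt.restrictScalars ℝ
  simp only [wirtingerD, h.fderiv]
  simp only [ContinuousLinearMap.coe_restrictScalars', ContinuousLinearMap.toSpanSingleton_apply,
    smul_eq_mul]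
  linear_combination (-(2 : ℂ)⁻¹ * deriv u z) * Complex.I_mul_I

theorem wirtingerD_conj {u : ℂ → ℂ} {z : ℂ} (hu : DifferentiableAt ℂ u z) :
    wirtingerD (fun w => (starRingEnd ℂ) (u w)) z = 0 := by
  have h := (Complex.conjCLE.toContinuousLinearMap.hasFDerivAt (x := u z)).comp z
    (hu.hasDerivAt.hasFDerivAt.restrictScalars ℝ)
  have h' : HasFDerivAt (fun w => (starRingEnd ℂ) (u w)) _ z := h
  simp only [wirtingerD, h'.fderiv]
  simp [← mul_assoc]

theorem wirtingerD_matrix_apply {m n : Type*} [Fintype m] [Fintype n] {u : ℂ → Matrix m n ℂ}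
    {z : ℂ} (hu : ∀ j k, DifferentiableAt ℝ (fun w => u w j k) z) (j : m) (k : n) :
    wirtingerD u z j k = wirtingerD (fun w => u w j k) z := by
  classical
  have hsum : u = fun w => ∑ j, ∑ k, u w j k • Matrix.single j k (1 : ℂ) := funext fun w => by
    simpa only [Matrix.smul_single, smul_eq_mul, mul_one] using matrix_eq_sum_single (u w)
  have key : wirtingerD u z =
      Matrix.of fun j k => wirtingerD (fun w => u w j k) z := by
    conv_lhs => rw [hsum]
    rw [wirtingerD_sum fun j _ => DifferentiableAt.fun_sum fun k _ => (hu j k).smul_const _]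
    simp_rw [wirtingerD_sum fun k _ => (hu _ k).smul_const _, wirtingerD_smul_const (hu _ _)]
    simpa only [Matrix.smul_single, smul_eq_mul, mul_one, Matrix.of_apply] using
      (matrix_eq_sum_single (Matrix.of fun j k => wirtingerD (fun w => u w j k) z)).symm
  rw [key, Matrix.of_apply]

open scoped ComplexOrder in
theorem sum_conj_mul_self_ne_zero {ι : Type*} [Fintype ι] {v : ι → ℂ} (hv : v ≠ 0) :
    ∑ l, (starRingEnd ℂ) (v l) * v l ≠ 0 := fun h =>
  hv (dotProduct_star_self_eq_zero.1 (by simpa [dotProduct, mul_comm] using h))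

/-- The Wirtinger derivative of the rank-one projector onto a nonvanishing holomorphic curve. -/
theorem wirtingerD_proj0_apply {N : ℕ} {f : ℂ → Fin N → ℂ} (hf : Differentiable ℂ f)
    (hne : ∀ ξ, f ξ ≠ 0) (ξ : ℂ) (j k : Fin N) :
    wirtingerD (proj0 f) ξ j k =
      (deriv (fun w => f w j) ξ - f ξ j *
        (∑ l, (starRingEnd ℂ) (f ξ l) * deriv (fun w => f w l) ξ) /
          (∑ l, (starRingEnd ℂ) (f ξ l) * f ξ l)) * (starRingEnd ℂ) (f ξ k) /
        (∑ l, (starRingEnd ℂ) (f ξ l) * f ξ l) := by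
  have hd : ∀ l, DifferentiableAt ℂ (fun w => f w l) ξ := fun l => differentiableAt_pi.1 (hf ξ) l
  have hr : ∀ l, DifferentiableAt ℝ (fun w => f w l) ξ := fun l => (hd l).restrictScalars ℝ
  have hc : ∀ l, DifferentiableAt ℝ (fun w => (starRingEnd ℂ) (f w l)) ξ := fun l =>
    Complex.conjCLE.differentiableAt.comp ξ (hr l)
  have hS : DifferentiableAt ℝ (fun w => ∑ l, (starRingEnd ℂ) (f w l) * f w l) ξ :=
    DifferentiableAt.fun_sum fun l _ => (hc l).fun_mul (hr l)
  have hSD : wirtingerD (fun w => ∑ l, (starRingEnd ℂ) (f w l) * f w l) ξ =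
      ∑ l, (starRingEnd ℂ) (f ξ l) * deriv (fun w => f w l) ξ := by
    rw [wirtingerD_sum fun l _ => (hc l).fun_mul (hr l)]
    refine Finset.sum_congr rfl fun l _ => ?_
    rw [wirtingerD_mul (hc l) (hr l), wirtingerD_conj (hd l), wirtingerD_eq_deriv (hd l),
      zero_mul, zero_add]
  have hS0 := fun w => sum_conj_mul_self_ne_zero (hne w)
  have hP : ∀ j k, DifferentiableAt ℝ (fun w => proj0 f w j k) ξ := fun j k => by
    simpa only [proj0, div_eq_mul_inv] using ((hr j).fun_mul (hc k)).fun_mul (hS.fun_inv (hS0 ξ))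
  have hmul : (fun w => proj0 f w j k * ∑ l, (starRingEnd ℂ) (f w l) * f w l) =
      fun w => f w j * (starRingEnd ℂ) (f w k) :=
    funext fun w => div_mul_cancel₀ _ (hS0 w)
  have key := congrArg (fun u => wirtingerD u ξ) hmul
  simp only [wirtingerD_mul (hP j k) hS, wirtingerD_mul (hr j) (hc k), hSD,
    wirtingerD_conj (hd _), wirtingerD_eq_deriv (hd _), mul_zero, add_zero] at key
  rw [wirtingerD_matrix_apply hP, eq_div_iff (hS0 ξ), eq_sub_of_add_eq key, proj0]
  ring

theorem rank_one_projector_wirtinger (N : ℕ) (f : ℂ → Fin N → ℂ)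
    (hf : Differentiable ℂ f) (hne : ∀ ξ, f ξ ≠ 0) (ξ : ℂ) :
    proj0 f ξ * wirtingerD (proj0 f) ξ = 0 ∧
    wirtingerD (proj0 f) ξ * proj0 f ξ = wirtingerD (proj0 f) ξ ∧
    wirtingerD (proj0 f) ξ * proj0 f ξ - proj0 f ξ * wirtingerD (proj0 f) ξ
      = wirtingerD (proj0 f) ξ := by
  have hS := sum_conj_mul_self_ne_zero (hne ξ)
  have hD := wirtingerD_proj0_apply hf hne ξ
  set S := ∑ l, (starRingEnd ℂ) (f ξ l) * f ξ l with hS_def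
  set c := ∑ l, (starRingEnd ℂ) (f ξ l) * deriv (fun w => f w l) ξ with hc_def
  have left : proj0 f ξ * wirtingerD (proj0 f) ξ = 0 := by
    ext j k
    have hterm : ∀ l, proj0 f ξ j l * wirtingerD (proj0 f) ξ l k =
        f ξ j * (starRingEnd ℂ) (f ξ k) / S ^ 2 *
          ((starRingEnd ℂ) (f ξ l) * deriv (fun w => f w l) ξ -
            c / S * ((starRingEnd ℂ) (f ξ l) * f ξ l)) := fun l => by
      rw [hD, proj0, ← hS_def]
      ring
    simp only [Matrix.mul_apply, hterm, ← Finset.mul_sum, Finset.sum_sub_distrib, ← hS_def,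
      ← hc_def, div_mul_cancel₀ _ hS, sub_self, mul_zero, Matrix.zero_apply]
  have right : wirtingerD (proj0 f) ξ * proj0 f ξ = wirtingerD (proj0 f) ξ := by
    ext j k
    have hterm : ∀ l, wirtingerD (proj0 f) ξ j l * proj0 f ξ l k =
        wirtingerD (proj0 f) ξ j k / S * ((starRingEnd ℂ) (f ξ l) * f ξ l) := fun l => by
      rw [hD, hD, proj0, ← hS_def]
      ring
    simp only [Matrix.mul_apply, hterm, ← Finset.mul_sum, ← hS_def, div_mul_cancel₀ _ hS]
  exact ⟨left, right, by rw [left, right, sub_zero]⟩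
end

section
/- Let f : ℂ → ℂ^N be differentiable (holomorphic) with f(ξ) ≠ 0 for all ξ, and define P(ξ) := 1 - (f(ξ) ⊗ f(ξ)†)/(f(ξ)† · f(ξ)). Then at every point ξ the Wirtinger derivatives of P satisfy the commutator identities [∂P, P](ξ) = - ∂P(ξ) and [∂̄P, P](ξ) = ∂̄P(ξ), where [A, B] = A * B - B * A. -/
open Matrix Complex

attribute [local instance] Matrix.normedAddCommGroup Matrix.normedSpace

/-- The rank-(N-1) projector P = 1 - (f ⊗ f†)/(f† · f). -/
noncomputable def projP {N : ℕ} (f : ℂ → Fin N → ℂ) (ξ : ℂ) :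
    Matrix (Fin N) (Fin N) ℂ :=
  1 - Matrix.of (fun j k => f ξ j * (starRingEnd ℂ) (f ξ k) /
    (∑ l, (starRingEnd ℂ) (f ξ l) * f ξ l))

/-- `u` is real-differentiable at `z` with differential `v ↦ v • a + conj v • b`. -/
def HasWirtingerAt {E : Type*} [NormedAddCommGroup E] [NormedSpace ℂ E]
    (u : ℂ → E) (a b : E) (z : ℂ) : Prop :=
  ∃ L : ℂ →L[ℝ] E, HasFDerivAt u L z ∧ ∀ v, L v = v • a + (starRingEnd ℂ) v • b

namespace HasWirtingerAt

section Vector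

variable {E : Type*} [NormedAddCommGroup E] [NormedSpace ℂ E] {u : ℂ → E} {a b : E} {z : ℂ}

theorem wirtingerD_eq (h : HasWirtingerAt u a b z) : wirtingerD u z = a := by
  obtain ⟨L, hL, hv⟩ := h
  simp only [wirtingerD, hL.fderiv, hv, map_one, Complex.conj_I]
  match_scalars
  · linear_combination (-(1 / 2 : ℂ)) * Complex.I_mul_I
  · linear_combination (1 / 2 : ℂ) * Complex.I_mul_I

theorem wirtingerDBar_eq (h : HasWirtingerAt u a b z) : wirtingerDBar u z = b := by
  obtain ⟨L, hL, hv⟩ := h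
  simp only [wirtingerDBar, hL.fderiv, hv, map_one, Complex.conj_I]
  match_scalars
  · linear_combination (1 / 2 : ℂ) * Complex.I_mul_I
  · linear_combination (-(1 / 2 : ℂ)) * Complex.I_mul_I

theorem const_sub (c : E) (h : HasWirtingerAt u a b z) :
    HasWirtingerAt (fun x => c - u x) (-a) (-b) z := by
  obtain ⟨L, hL, hv⟩ := h
  refine ⟨-L, hL.const_sub c, fun v => ?_⟩
  rw [_root_.neg_apply, hv]
  module

theorem sum {ι : Type*} (s : Finset ι) {u : ι → ℂ → E} {a b : ι → E}
    (h : ∀ i ∈ s, HasWirtingerAt (u i) (a i) (b i) z) :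
    HasWirtingerAt (fun x => ∑ i ∈ s, u i x) (∑ i ∈ s, a i) (∑ i ∈ s, b i) z := by
  choose! L hL hv using h
  refine ⟨∑ i ∈ s, L i, HasFDerivAt.fun_sum hL, fun v => ?_⟩
  rw [_root_.sum_apply, Finset.sum_congr rfl fun i hi => hv i hi v,
    Finset.sum_add_distrib, Finset.smul_sum, Finset.smul_sum]

end Vector

section Scalar

variable {u w : ℂ → ℂ} {a b c d z : ℂ}

theorem of_hasDerivAt (h : HasDerivAt u a z) : HasWirtingerAt u a 0 z :=
  ⟨_, h.hasFDerivAt.restrictScalars ℝ, fun v => by simp⟩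

theorem conj (h : HasWirtingerAt u a b z) :
    HasWirtingerAt (fun x => (starRingEnd ℂ) (u x)) ((starRingEnd ℂ) b) ((starRingEnd ℂ) a) z := by
  obtain ⟨L, hL, hv⟩ := h
  refine ⟨_, Complex.conjCLE.toContinuousLinearMap.hasFDerivAt.comp z hL, fun v => ?_⟩
  simp [hv, add_comm]

theorem mul (h : HasWirtingerAt u a b z) (k : HasWirtingerAt w c d z) :
    HasWirtingerAt (fun x => u x * w x) (u z * c + w z * a) (u z * d + w z * b) z := by
  obtain ⟨L, hL, hv⟩ := h
  obtain ⟨M, hM, hw⟩ := k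
  refine ⟨_, hL.mul hM, fun v => ?_⟩
  simp only [_root_.add_apply, _root_.smul_apply, hv, hw, smul_eq_mul]
  ring

theorem inv (h : HasWirtingerAt u a b z) (h0 : u z ≠ 0) :
    HasWirtingerAt (fun x => (u x)⁻¹) (-a / u z ^ 2) (-b / u z ^ 2) z := by
  obtain ⟨L, hL, hv⟩ := h
  refine ⟨_, ((hasDerivAt_inv h0).hasFDerivAt.restrictScalars ℝ).comp z hL, fun v => ?_⟩
  simp [hv]
  ring

end Scalar

theorem matrix {m n : Type*} [Fintype m] [Fintype n] {u : ℂ → Matrix m n ℂ} {a b : Matrix m n ℂ}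
    {z : ℂ} (h : ∀ j k, HasWirtingerAt (fun x => u x j k) (a j k) (b j k) z) :
    HasWirtingerAt u a b z := by
  choose L hL hv using h
  refine ⟨ContinuousLinearMap.pi fun j => ContinuousLinearMap.pi fun k => L j k,
    hasFDerivAt_pi.2 fun j => hasFDerivAt_pi.2 fun k => hL j k, fun v => ?_⟩
  ext j k
  exact hv j k v

end HasWirtingerAt

section RankOne

variable {n K : Type*} [Fintype n] [DecidableEq n] [Field K]

/-- With `Q` the projection onto the span of `x` along the kernel of `w`, the variation `A` of `Q`
in the direction of a change `d` of `x` satisfies `[-A, 1 - Q] = A`. -/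
theorem commutator_variation_left (x w d : n → K) (h : w ⬝ᵥ x ≠ 0) :
    let Q := (w ⬝ᵥ x)⁻¹ • vecMulVec x w
    let A := (w ⬝ᵥ x)⁻¹ • vecMulVec d w - ((w ⬝ᵥ d) / (w ⬝ᵥ x) ^ 2) • vecMulVec x w
    (-A) * (1 - Q) - (1 - Q) * (-A) = A := by
  intro Q A
  have hAQ : A * Q = A := by
    simp only [A, Q, sub_mul, smul_mul_assoc, mul_smul_comm, vecMulVec_mul_vecMulVec,
      vecMulVec_smul]
    match_scalars <;> field_simp
  have hQA : Q * A = 0 := by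
    simp only [A, Q, mul_sub, smul_mul_assoc, mul_smul_comm, vecMulVec_mul_vecMulVec,
      vecMulVec_smul]
    match_scalars
    field_simp
    ring
  have : -A * (1 - Q) - (1 - Q) * -A = A * Q - Q * A := by noncomm_ring
  rw [this, hAQ, hQA, sub_zero]

/-- With `Q` the projection onto the span of `x` along the kernel of `w`, the variation `B` of `Q`
in the direction of a change `e` of `w` satisfies `[-B, 1 - Q] = -B`. -/
theorem commutator_variation_right (x w e : n → K) (h : w ⬝ᵥ x ≠ 0) :
    let Q := (w ⬝ᵥ x)⁻¹ • vecMulVec x w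
    let B := (w ⬝ᵥ x)⁻¹ • vecMulVec x e - ((e ⬝ᵥ x) / (w ⬝ᵥ x) ^ 2) • vecMulVec x w
    (-B) * (1 - Q) - (1 - Q) * (-B) = -B := by
  intro Q B
  have hBQ : B * Q = 0 := by
    simp only [B, Q, sub_mul, smul_mul_assoc, mul_smul_comm, vecMulVec_mul_vecMulVec,
      vecMulVec_smul]
    match_scalars
    field_simp
    ring
  have hQB : Q * B = B := by
    simp only [B, Q, mul_sub, smul_mul_assoc, mul_smul_comm, vecMulVec_mul_vecMulVec,
      vecMulVec_smul]
    match_scalars <;> field_simp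
  have : -B * (1 - Q) - (1 - Q) * -B = B * Q - Q * B := by noncomm_ring
  rw [this, hBQ, hQB, zero_sub]

end RankOne

theorem projP_eq {N : ℕ} (f : ℂ → Fin N → ℂ) (ξ : ℂ) :
    projP f ξ = 1 - (star (f ξ) ⬝ᵥ f ξ)⁻¹ • vecMulVec (f ξ) (star (f ξ)) := by
  ext j k
  simp [projP, vecMulVec_apply, dotProduct, div_eq_inv_mul]

open scoped ComplexOrder in
theorem star_dotProduct_self_ne_zero {n : Type*} [Fintype n] {v : n → ℂ} (hv : v ≠ 0) :
    star v ⬝ᵥ v ≠ 0 :=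
  dotProduct_star_self_eq_zero.not.2 hv

theorem hasWirtingerAt_projP {N : ℕ} {f : ℂ → Fin N → ℂ} {d : Fin N → ℂ} {ξ : ℂ}
    (hf : HasDerivAt f d ξ) (hne : f ξ ≠ 0) :
    HasWirtingerAt (projP f)
      (-((star (f ξ) ⬝ᵥ f ξ)⁻¹ • vecMulVec d (star (f ξ)) -
        ((star (f ξ) ⬝ᵥ d) / (star (f ξ) ⬝ᵥ f ξ) ^ 2) • vecMulVec (f ξ) (star (f ξ))))
      (-((star (f ξ) ⬝ᵥ f ξ)⁻¹ • vecMulVec (f ξ) (star d) -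
        ((star d ⬝ᵥ f ξ) / (star (f ξ) ⬝ᵥ f ξ) ^ 2) • vecMulVec (f ξ) (star (f ξ)))) ξ := by
  have hs : star (f ξ) ⬝ᵥ f ξ ≠ 0 := star_dotProduct_self_ne_zero hne
  have hc (j : Fin N) : HasWirtingerAt (fun x => f x j) (d j) 0 ξ :=
    .of_hasDerivAt (hasDerivAt_pi.1 hf j)
  have hsum := HasWirtingerAt.sum Finset.univ fun l _ => (hc l).conj.mul (hc l)
  refine HasWirtingerAt.const_sub 1 (HasWirtingerAt.matrix fun j k => ?_)
  convert ((hc j).mul (hc k).conj).mul (hsum.inv hs) using 1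
  · ext x
    simp [div_eq_mul_inv]
  · simp [vecMulVec_apply, dotProduct]
    ring
  · simp [vecMulVec_apply, dotProduct, mul_comm]
    ring

theorem projector_commutator_identities (N : ℕ) (f : ℂ → Fin N → ℂ)
    (hf : Differentiable ℂ f) (hne : ∀ ξ, f ξ ≠ 0) (ξ : ℂ) :
    wirtingerD (projP f) ξ * projP f ξ - projP f ξ * wirtingerD (projP f) ξ
      = - wirtingerD (projP f) ξ ∧
    wirtingerDBar (projP f) ξ * projP f ξ - projP f ξ * wirtingerDBar (projP f) ξ
      = wirtingerDBar (projP f) ξ := by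
  have hs : star (f ξ) ⬝ᵥ f ξ ≠ 0 := star_dotProduct_self_ne_zero (hne ξ)
  have h := hasWirtingerAt_projP (hf ξ).hasDerivAt (hne ξ)
  rw [h.wirtingerD_eq, h.wirtingerDBar_eq, projP_eq, neg_neg]
  exact ⟨commutator_variation_left _ _ _ hs, commutator_variation_right _ _ _ hs⟩
end

section
/- Let f : ℂ → ℂ^N be differentiable (holomorphic) with f(ξ) ≠ 0 for all ξ, let P(ξ) := 1 - (f(ξ) ⊗ f(ξ)†)/(f(ξ)† · f(ξ)), and define X(ξ) := Complex.I • (((1 - N : ℂ)/N) • 1 + P(ξ)). Then X(ξ) is anti-Hermitian with trace zero (X(ξ)ᴴ = -X(ξ) and trace X(ξ) = 0), and X satisfies the generalized Weierstrass formula for immersion: ∂X(ξ) = - Complex.I • [∂P, P](ξ) and ∂̄X(ξ) = Complex.I • [∂̄P, P](ξ) at every ξ. -/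
open Matrix Complex

attribute [local instance] Matrix.normedAddCommGroup Matrix.normedSpace

/-- The generalized Weierstrass immersion X = i((1-N)/N • 1 + P). -/
noncomputable def immX {N : ℕ} (f : ℂ → Fin N → ℂ) (ξ : ℂ) :
    Matrix (Fin N) (Fin N) ℂ :=
  Complex.I • (((1 - (N : ℂ)) / (N : ℂ)) • (1 : Matrix (Fin N) (Fin N) ℂ) + projP f ξ)

/-- If the real derivative of `u` at `z` is `v ↦ v • A + conj v • B`, then `∂u(z) = A`. -/
theorem wirtingerD_eq_of_hasFDerivAt {E : Type*} [NormedAddCommGroup E] [NormedSpace ℂ E]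
    {u : ℂ → E} {z : ℂ} {L : ℂ →L[ℝ] E} {A B : E} (h : HasFDerivAt u L z)
    (hL : ∀ v, L v = v • A + (starRingEnd ℂ) v • B) : wirtingerD u z = A := by
  have hI : Complex.I • Complex.I • A = -A := by rw [smul_smul, I_mul_I, neg_one_smul]
  have hI' : Complex.I • Complex.I • B = -B := by rw [smul_smul, I_mul_I, neg_one_smul]
  rw [wirtingerD, h.fderiv, hL, hL, map_one, conj_I, one_smul, one_smul, smul_add, hI, neg_smul,
    smul_neg, hI', inv_smul_eq_iff₀ two_ne_zero, two_smul]
  abel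

/-- If the real derivative of `u` at `z` is `v ↦ v • A + conj v • B`, then `∂̄u(z) = B`. -/
theorem wirtingerDBar_eq_of_hasFDerivAt {E : Type*} [NormedAddCommGroup E] [NormedSpace ℂ E]
    {u : ℂ → E} {z : ℂ} {L : ℂ →L[ℝ] E} {A B : E} (h : HasFDerivAt u L z)
    (hL : ∀ v, L v = v • A + (starRingEnd ℂ) v • B) : wirtingerDBar u z = B := by
  have hI : Complex.I • Complex.I • A = -A := by rw [smul_smul, I_mul_I, neg_one_smul]
  have hI' : Complex.I • Complex.I • B = -B := by rw [smul_smul, I_mul_I, neg_one_smul]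
  rw [wirtingerDBar, h.fderiv, hL, hL, map_one, conj_I, one_smul, one_smul, smul_add Complex.I, hI,
    neg_smul, smul_neg, hI', inv_smul_eq_iff₀ two_ne_zero, two_smul]
  abel

theorem star_dotProduct_self_ne_zero_s5 {N : ℕ} {w : Fin N → ℂ} (h : w ≠ 0) : star w ⬝ᵥ w ≠ 0 := by
  open scoped ComplexOrder in
  exact dotProduct_star_self_eq_zero.not.2 h

theorem projP_conjTranspose {N : ℕ} (f : ℂ → Fin N → ℂ) (ξ : ℂ) :
    (projP f ξ)ᴴ = projP f ξ := by
  have hs : star (star (f ξ) ⬝ᵥ f ξ) = star (f ξ) ⬝ᵥ f ξ := by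
    rw [← star_dotProduct_star, star_star]
  rw [projP_eq, conjTranspose_sub, conjTranspose_one, conjTranspose_smul,
    conjTranspose_vecMulVec, star_inv₀, hs, star_star]

theorem projP_mulVec_self {N : ℕ} {f : ℂ → Fin N → ℂ} {ξ : ℂ} (h : f ξ ≠ 0) :
    projP f ξ *ᵥ f ξ = 0 := by
  have hs : star (f ξ) ⬝ᵥ f ξ ≠ 0 := star_dotProduct_self_ne_zero_s5 h
  rw [projP_eq, sub_mulVec, one_mulVec, smul_mulVec, vecMulVec_mulVec]
  ext j
  simp [hs]

theorem star_vecMul_projP {N : ℕ} {f : ℂ → Fin N → ℂ} {ξ : ℂ} (h : f ξ ≠ 0) :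
    star (f ξ) ᵥ* projP f ξ = 0 := by
  rw [← projP_conjTranspose, ← star_mulVec, projP_mulVec_self h, star_zero]

theorem projP_mul_self {N : ℕ} {f : ℂ → Fin N → ℂ} {ξ : ℂ} (h : f ξ ≠ 0) :
    projP f ξ * projP f ξ = projP f ξ := by
  nth_rw 2 [projP_eq]
  rw [mul_sub, mul_one, mul_smul_comm, mul_vecMulVec, projP_mulVec_self h, zero_vecMulVec,
    smul_zero, sub_zero]

theorem projP_trace {N : ℕ} {f : ℂ → Fin N → ℂ} {ξ : ℂ} (h : f ξ ≠ 0) :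
    (projP f ξ).trace = N - 1 := by
  have hs : star (f ξ) ⬝ᵥ f ξ ≠ 0 := star_dotProduct_self_ne_zero_s5 h
  rw [projP_eq, trace_sub, trace_one, trace_smul, trace_vecMulVec, dotProduct_comm (f ξ),
    smul_eq_mul, inv_mul_cancel₀ hs, Fintype.card_fin]

/-- The real derivative of `projP f` for holomorphic `f`, split into its complex linear and
antilinear parts. -/
theorem exists_hasFDerivAt_projP {N : ℕ} {f : ℂ → Fin N → ℂ} {ξ : ℂ}
    (hf : DifferentiableAt ℂ f ξ) (h : f ξ ≠ 0) :
    ∃ L : ℂ →L[ℝ] Matrix (Fin N) (Fin N) ℂ, HasFDerivAt (projP f) L ξ ∧ ∀ v, L v =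
      v • -((star (f ξ) ⬝ᵥ f ξ)⁻¹ • (projP f ξ * vecMulVec (deriv f ξ) (star (f ξ)))) +
      (starRingEnd ℂ) v •
        -((star (f ξ) ⬝ᵥ f ξ)⁻¹ • (vecMulVec (f ξ) (star (deriv f ξ)) * projP f ξ)) := by
  have hs : star (f ξ) ⬝ᵥ f ξ ≠ 0 := star_dotProduct_self_ne_zero_s5 h
  have hs' : ∑ l, (starRingEnd ℂ) (f ξ l) * f ξ l ≠ 0 := hs
  have hd (j : Fin N) : HasFDerivAt (fun z => f z j)
      ((ContinuousLinearMap.toSpanSingleton ℂ (deriv f ξ j)).restrictScalars ℝ) ξ :=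
    (hasDerivAt_pi.1 hf.hasDerivAt j).hasFDerivAt.restrictScalars ℝ
  have hc (j : Fin N) : HasFDerivAt (fun z => (starRingEnd ℂ) (f z j)) _ ξ := (hd j).star
  have hsum : HasFDerivAt (fun z => ∑ l, (starRingEnd ℂ) (f z l) * f z l) _ ξ :=
    HasFDerivAt.fun_sum fun l (_ : l ∈ Finset.univ) => (hc l).mul (hd l)
  have hinv : HasFDerivAt (fun z => (∑ l, (starRingEnd ℂ) (f z l) * f z l)⁻¹) _ ξ :=
    ((hasDerivAt_inv hs').hasFDerivAt.restrictScalars ℝ).comp ξ hsum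
  have hsv (v : ℂ) : ∑ l, ((starRingEnd ℂ) (f ξ l) * (v * deriv f ξ l) +
      f ξ l * ((starRingEnd ℂ) v * (starRingEnd ℂ) (deriv f ξ l))) =
      v * (star (f ξ) ⬝ᵥ deriv f ξ) + (starRingEnd ℂ) v * (star (deriv f ξ) ⬝ᵥ f ξ) := by
    simp only [dotProduct, Finset.mul_sum, ← Finset.sum_add_distrib, Pi.star_apply,
      ← starRingEnd_apply]
    exact Finset.sum_congr rfl fun l _ => by ring
  have hss : ∑ l, (starRingEnd ℂ) (f ξ l) * f ξ l = star (f ξ) ⬝ᵥ f ξ := rfl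
  have hq (j k : Fin N) : ∃ L : ℂ →L[ℝ] ℂ, HasFDerivAt (fun z => projP f z j k) L ξ ∧ ∀ v, L v =
      -((star (f ξ) ⬝ᵥ f ξ)⁻¹ * (v * deriv f ξ j * (starRingEnd ℂ) (f ξ k) +
        f ξ j * ((starRingEnd ℂ) v * (starRingEnd ℂ) (deriv f ξ k))) -
        f ξ j * (starRingEnd ℂ) (f ξ k) * ((star (f ξ) ⬝ᵥ f ξ)⁻¹ ^ 2 *
          (v * (star (f ξ) ⬝ᵥ deriv f ξ) + (starRingEnd ℂ) v * (star (deriv f ξ) ⬝ᵥ f ξ)))) := by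
    refine ⟨_, (((hd j).mul (hc k)).mul hinv).const_sub
      ((1 : Matrix (Fin N) (Fin N) ℂ) j k), fun v => ?_⟩
    simp [hss, hsv]
    ring
  choose L hL hLv using hq
  refine ⟨_, hasFDerivAt_pi.2 fun j => hasFDerivAt_pi.2 fun k => hL j k, fun v => ?_⟩
  have hPg : projP f ξ *ᵥ deriv f ξ = deriv f ξ -
      ((star (f ξ) ⬝ᵥ f ξ)⁻¹ * (star (f ξ) ⬝ᵥ deriv f ξ)) • f ξ := by
    rw [projP_eq, sub_mulVec, one_mulVec, smul_mulVec, vecMulVec_mulVec, op_smul_eq_smul, smul_smul]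
  have hgP : star (deriv f ξ) ᵥ* projP f ξ = star (deriv f ξ) -
      ((star (f ξ) ⬝ᵥ f ξ)⁻¹ * (star (deriv f ξ) ⬝ᵥ f ξ)) • star (f ξ) := by
    rw [projP_eq, vecMul_sub, vecMul_one, vecMul_smul, vecMul_vecMulVec, smul_smul]
  rw [mul_vecMulVec, vecMulVec_mul, hPg, hgP]
  ext j k
  refine (hLv j k v).trans ?_
  simp [vecMulVec_apply]
  ring

theorem weierstrass_immersion_properties (N : ℕ) (f : ℂ → Fin N → ℂ)
    (hf : Differentiable ℂ f) (hne : ∀ ξ, f ξ ≠ 0) (ξ : ℂ) :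
    (immX f ξ)ᴴ = -(immX f ξ) ∧
    (immX f ξ).trace = 0 ∧
    wirtingerD (immX f) ξ =
      -(Complex.I • (wirtingerD (projP f) ξ * projP f ξ -
        projP f ξ * wirtingerD (projP f) ξ)) ∧
    wirtingerDBar (immX f) ξ =
      Complex.I • (wirtingerDBar (projP f) ξ * projP f ξ -
        projP f ξ * wirtingerDBar (projP f) ξ) := by
  have hN : (N : ℂ) ≠ 0 := by
    intro h0
    obtain rfl : N = 0 := by exact_mod_cast h0
    exact hne ξ (Subsingleton.elim _ _)
  have hP := projP_mul_self (hne ξ)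
  obtain ⟨L, hL, hLv⟩ := exists_hasFDerivAt_projP (hf ξ) (hne ξ)
  have hX : HasFDerivAt (immX f) (Complex.I • L) ξ := (hL.const_add _).const_smul Complex.I
  have hXv (v : ℂ) := congrArg (Complex.I • ·) (hLv v)
  simp only [smul_add, smul_comm Complex.I _ (_ : Matrix (Fin N) (Fin N) ℂ)] at hXv
  refine ⟨?_, ?_, ?_, ?_⟩
  · rw [immX, conjTranspose_smul, conjTranspose_add, conjTranspose_smul, projP_conjTranspose]
    simp [add_comm]
  · rw [immX, trace_smul, trace_add, trace_smul, trace_one, projP_trace (hne ξ)]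
    simp [div_mul_cancel₀ _ hN]
  · rw [wirtingerD_eq_of_hasFDerivAt hX hXv, wirtingerD_eq_of_hasFDerivAt hL hLv]
    simp only [neg_mul, mul_neg, smul_mul_assoc, mul_smul_comm, mul_assoc, vecMulVec_mul,
      star_vecMul_projP (hne ξ), vecMulVec_zero, mul_zero]
    simp [← mul_assoc, hP]
  · rw [wirtingerDBar_eq_of_hasFDerivAt hX hXv, wirtingerDBar_eq_of_hasFDerivAt hL hLv]
    simp only [neg_mul, mul_neg, smul_mul_assoc, mul_smul_comm, ← mul_assoc, mul_vecMulVec,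
      projP_mulVec_self (hne ξ), zero_vecMulVec, zero_mul]
    simp [mul_assoc, hP]
end

section
/- Let N ≥ 2 and let f : ℂ → ℂ^N be the Veronese map with components f(ξ) r = Real.sqrt (Nat.choose (N-1) r) * ξ^r for r = 0, …, N-1, and let P(ξ) := 1 - (f(ξ) ⊗ f(ξ)†)/(f(ξ)† · f(ξ)). Then for every ξ ∈ ℂ: (i) f(ξ)† · f(ξ) = (1 + |ξ|²)^{N-1}, and (ii) the induced metric coefficient (f′(ξ))† ⋅ (P(ξ).mulVec (f′(ξ))) / (f(ξ)† · f(ξ)) equals (N - 1)/(1 + |ξ|²)², where f′ = deriv f. -/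
open Matrix Complex

lemma sum_choose_mul_pow_mul_pow (n : ℕ) (w z : ℂ) :
    ∑ k ∈ Finset.range (n + 1), (n.choose k : ℂ) * (w ^ k * z ^ k) = (1 + w * z) ^ n := by
  rw [add_comm 1, add_pow]
  refine Finset.sum_congr rfl fun k _ => ?_
  rw [one_pow, mul_pow]
  ring

lemma sum_choose_mul_pow_mul_deriv_pow (n : ℕ) (w z : ℂ) :
    ∑ k ∈ Finset.range (n + 1), (n.choose k : ℂ) * (w ^ k * (k * z ^ (k - 1))) =
      n * w * (1 + w * z) ^ (n - 1) := by
  have hsum : HasDerivAt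
      (fun z : ℂ => ∑ k ∈ Finset.range (n + 1), (n.choose k : ℂ) * (w ^ k * z ^ k))
      (∑ k ∈ Finset.range (n + 1), (n.choose k : ℂ) * (w ^ k * (k * z ^ (k - 1)))) z :=
    HasDerivAt.fun_sum fun k _ => ((hasDerivAt_pow k z).const_mul _).const_mul _
  simp only [sum_choose_mul_pow_mul_pow] at hsum
  have hpow := (((hasDerivAt_id z).const_mul w).const_add 1).pow n
  refine (hsum.unique hpow).trans ?_
  simp only [id]
  ring

lemma sum_choose_mul_deriv_pow_mul_deriv_pow (n : ℕ) (w z : ℂ) :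
    ∑ k ∈ Finset.range (n + 1),
        (n.choose k : ℂ) * ((k * w ^ (k - 1)) * (k * z ^ (k - 1))) =
      n * (1 + w * z) ^ (n - 1) +
        n * w * z * ((n - 1 : ℕ) * (1 + w * z) ^ (n - 1 - 1)) := by
  have hsum : HasDerivAt
      (fun w : ℂ => ∑ k ∈ Finset.range (n + 1),
        (n.choose k : ℂ) * (w ^ k * (k * z ^ (k - 1))))
      (∑ k ∈ Finset.range (n + 1),
        (n.choose k : ℂ) * ((k * w ^ (k - 1)) * (k * z ^ (k - 1)))) w :=
    HasDerivAt.fun_sum fun k _ => ((hasDerivAt_pow k w).mul_const _).const_mul _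
  simp only [sum_choose_mul_pow_mul_deriv_pow] at hsum
  have hpow := ((hasDerivAt_id w).const_mul (n : ℂ)).mul
    ((((hasDerivAt_id w).mul_const z).const_add 1).pow (n - 1))
  refine (hsum.unique hpow).trans ?_
  simp only [id, Pi.pow_apply]
  ring

lemma sum_conj_mul_mulVec_one_sub {ι : Type*} [Fintype ι] [DecidableEq ι] (u v : ι → ℂ)
    (a : ℂ) :
    ∑ l, (starRingEnd ℂ) (v l) *
        ((1 - Matrix.of fun j k => u j * (starRingEnd ℂ) (u k) / a).mulVec v l) =
      ∑ l, (starRingEnd ℂ) (v l) * v l -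
        (∑ l, (starRingEnd ℂ) (v l) * u l) * (∑ k, (starRingEnd ℂ) (u k) * v k) / a := by
  rw [mul_div_assoc, Finset.sum_mul, ← Finset.sum_sub_distrib]
  refine Finset.sum_congr rfl fun l _ => ?_
  rw [Matrix.sub_mulVec, Matrix.one_mulVec, Pi.sub_apply, mul_sub, mul_assoc]
  congr 2
  simp only [Matrix.mulVec, dotProduct, Matrix.of_apply, Finset.sum_div, Finset.mul_sum]
  exact Finset.sum_congr rfl fun k _ => by ring

lemma sum_conj_sqrt_choose_mul (n : ℕ) (a b : ℕ → ℂ) :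
    ∑ l : Fin (n + 1), (starRingEnd ℂ) ((Real.sqrt (n.choose l) : ℂ) * a l) *
        ((Real.sqrt (n.choose l) : ℂ) * b l) =
      ∑ k ∈ Finset.range (n + 1), (n.choose k : ℂ) * ((starRingEnd ℂ) (a k) * b k) := by
  rw [← Fin.sum_univ_eq_sum_range
    (fun k => (n.choose k : ℂ) * ((starRingEnd ℂ) (a k) * b k))]
  refine Finset.sum_congr rfl fun l _ => ?_
  have hsq : (Real.sqrt (n.choose l) : ℂ) * Real.sqrt (n.choose l) = n.choose l := by
    rw [← Complex.ofReal_mul, Real.mul_self_sqrt (Nat.cast_nonneg _), Complex.ofReal_natCast]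
  rw [map_mul, Complex.conj_ofReal, ← hsq]
  ring

theorem veronese_metric (N : ℕ) (hN : 2 ≤ N) (f : ℂ → Fin N → ℂ)
    (hf : ∀ ξ r, f ξ r = (Real.sqrt (Nat.choose (N - 1) (r : ℕ)) : ℂ) * ξ ^ (r : ℕ))
    (P : ℂ → Matrix (Fin N) (Fin N) ℂ)
    (hP : ∀ ξ, P ξ = 1 - Matrix.of (fun j k => f ξ j * (starRingEnd ℂ) (f ξ k) /
      (∑ l, (starRingEnd ℂ) (f ξ l) * f ξ l)))
    (ξ : ℂ) :
    (∑ l, (starRingEnd ℂ) (f ξ l) * f ξ l) =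
      ((1 + Complex.normSq ξ : ℝ) : ℂ) ^ (N - 1) ∧
    (∑ l, (starRingEnd ℂ) (deriv f ξ l) * ((P ξ).mulVec (deriv f ξ) l)) /
        (∑ l, (starRingEnd ℂ) (f ξ l) * f ξ l) =
      ((N : ℂ) - 1) / (((1 + Complex.normSq ξ : ℝ) : ℂ)) ^ 2 := by
  obtain ⟨m, rfl⟩ := Nat.exists_eq_add_of_le' hN
  simp only [show m + 2 - 1 = m + 1 from rfl] at hf ⊢
  have hderiv : ∀ r, deriv f ξ r =
      (Real.sqrt ((m + 1).choose r) : ℂ) * ((r : ℕ) * ξ ^ ((r : ℕ) - 1)) := by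
    have h : HasDerivAt f (fun r : Fin (m + 2) =>
        (Real.sqrt ((m + 1).choose r) : ℂ) * ((r : ℕ) * ξ ^ ((r : ℕ) - 1))) ξ := by
      refine hasDerivAt_pi.2 fun r => ?_
      simp only [hf]
      exact (hasDerivAt_pow _ ξ).const_mul _
    exact fun r => congrFun h.deriv r
  have hs : ((1 + Complex.normSq ξ : ℝ) : ℂ) = 1 + (starRingEnd ℂ) ξ * ξ := by
    rw [Complex.ofReal_add, Complex.ofReal_one, Complex.normSq_eq_conj_mul_self]
  have hne : 1 + (starRingEnd ℂ) ξ * ξ ≠ 0 := by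
    rw [← hs, Complex.ofReal_ne_zero]
    exact (add_pos_of_pos_of_nonneg one_pos (Complex.normSq_nonneg ξ)).ne'
  have hff : ∑ l, (starRingEnd ℂ) (f ξ l) * f ξ l =
      (1 + (starRingEnd ℂ) ξ * ξ) ^ (m + 1) := by
    simp only [hf]
    rw [sum_conj_sqrt_choose_mul (m + 1) (fun k => ξ ^ k) (fun k => ξ ^ k)]
    simp only [map_pow, sum_choose_mul_pow_mul_pow]
  have hfd : ∑ l, (starRingEnd ℂ) (f ξ l) * deriv f ξ l =
      (m + 1) * (starRingEnd ℂ) ξ * (1 + (starRingEnd ℂ) ξ * ξ) ^ m := by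
    simp only [hf, hderiv]
    rw [sum_conj_sqrt_choose_mul (m + 1) (fun k => ξ ^ k) (fun k => k * ξ ^ (k - 1))]
    simp only [map_pow, sum_choose_mul_pow_mul_deriv_pow]
    simp
  have hdf : ∑ l, (starRingEnd ℂ) (deriv f ξ l) * f ξ l =
      (m + 1) * ξ * (1 + (starRingEnd ℂ) ξ * ξ) ^ m := by
    have h := congrArg (starRingEnd ℂ) hfd
    simp only [map_sum, map_mul, map_pow, map_add, map_one, map_natCast,
      Complex.conj_conj] at h
    rw [mul_comm ((starRingEnd ℂ) ξ), ← h]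
    exact Finset.sum_congr rfl fun l _ => mul_comm _ _
  have hdd : ∑ l, (starRingEnd ℂ) (deriv f ξ l) * deriv f ξ l =
      (m + 1) * (1 + (starRingEnd ℂ) ξ * ξ) ^ m +
        (m + 1) * (starRingEnd ℂ) ξ * ξ * (m * (1 + (starRingEnd ℂ) ξ * ξ) ^ (m - 1)) := by
    simp only [hderiv]
    rw [sum_conj_sqrt_choose_mul (m + 1) (fun k => k * ξ ^ (k - 1))
      (fun k => k * ξ ^ (k - 1))]
    simp only [map_mul, map_natCast, map_pow, sum_choose_mul_deriv_pow_mul_deriv_pow]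
    simp
  rw [hs]
  refine ⟨hff, ?_⟩
  rw [hP, sum_conj_mul_mulVec_one_sub, hff, hfd, hdf, hdd]
  have hpow : (m : ℂ) * (1 + (starRingEnd ℂ) ξ * ξ) ^ (m - 1) =
      m * (1 + (starRingEnd ℂ) ξ * ξ) ^ m / (1 + (starRingEnd ℂ) ξ * ξ) := by
    rw [eq_div_iff hne]
    cases m with
    | zero => simp
    | succ k => rw [Nat.add_sub_cancel, pow_succ]; ring
  rw [hpow]
  push_cast
  generalize (starRingEnd ℂ) ξ = w at hne
  field_simp
  ring
end

section
/- Define the eight functions of (x, y) ∈ ℝ² with r² := x² + y² and D := (1 + r²)²: X₁ = √2·x·r²/D, X₂ = √2·y·r²/D, X₃ = -r²(r² - 2)/(2D), X₄ = -√3·r²(r² + 2)/(2D), X₅ = √2·y/D, X₆ = 2xy/D, X₇ = -√2·x/D, X₈ = (-x² + y²)/D. Then for all (x, y): 4X₁² + 4X₂² + 4X₃² + (2/√3)·X₄ + X₅² + X₆² + X₇² + X₈² = 0. -/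
theorem veronese_affine_sphere (x y : ℝ) :
    let r2 := x ^ 2 + y ^ 2
    let D := (1 + r2) ^ 2
    let X1 := Real.sqrt 2 * x * r2 / D
    let X2 := Real.sqrt 2 * y * r2 / D
    let X3 := -(r2 * (r2 - 2)) / (2 * D)
    let X4 := -(Real.sqrt 3 * (r2 * (r2 + 2))) / (2 * D)
    let X5 := Real.sqrt 2 * y / D
    let X6 := 2 * x * y / D
    let X7 := -(Real.sqrt 2 * x) / D
    let X8 := (-x ^ 2 + y ^ 2) / D
    4 * X1 ^ 2 + 4 * X2 ^ 2 + 4 * X3 ^ 2 + (2 / Real.sqrt 3) * X4 +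
      X5 ^ 2 + X6 ^ 2 + X7 ^ 2 + X8 ^ 2 = 0 := by
  intro r2 D X1 X2 X3 X4 X5 X6 X7 X8
  have h2 : Real.sqrt 2 ^ 2 = 2 := Real.sq_sqrt (by norm_num)
  have h3 : Real.sqrt 3 ≠ 0 := by positivity
  have hD : 1 + (x ^ 2 + y ^ 2) ≠ 0 := by positivity
  have hX4 : (2 / Real.sqrt 3) * X4 = -(r2 * (r2 + 2)) / D := by
    simp only [X4, D, r2]
    field_simp
  rw [hX4]
  simp only [X1, X2, X3, X5, X6, X7, X8, D, r2, div_pow, mul_pow, neg_sq, h2]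
  field_simp
  ring
end

section
/- Let f : ℂ → ℂ³ be the Veronese map f(ξ) = (1, √2·ξ, ξ²). Then for every ξ ∈ ℂ, the vector P₊f(ξ) := f′(ξ) - ((f(ξ)† ⋅ f′(ξ))/(f(ξ)† ⋅ f(ξ))) • f(ξ) equals (√2/(1 + |ξ|²)) • (-√2·conj ξ, 1 - |ξ|², √2·ξ), where f′ = deriv f. -/
open Complex

theorem veronese_Pplus (f : ℂ → Fin 3 → ℂ)
    (hf : ∀ ξ, f ξ = ![1, (Real.sqrt 2 : ℂ) * ξ, ξ ^ 2]) (ξ : ℂ) :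
    deriv f ξ -
        ((∑ l, (starRingEnd ℂ) (f ξ l) * deriv f ξ l) /
          (∑ l, (starRingEnd ℂ) (f ξ l) * f ξ l)) • f ξ =
      ((Real.sqrt 2 : ℂ) / (1 + (Complex.normSq ξ : ℂ))) •
        ![-(Real.sqrt 2 : ℂ) * (starRingEnd ℂ) ξ,
          1 - (Complex.normSq ξ : ℂ),
          (Real.sqrt 2 : ℂ) * ξ] := by
  have hderiv : deriv f ξ = ![0, (Real.sqrt 2 : ℂ), 2 * ξ] := by
    refine HasDerivAt.deriv (hasDerivAt_pi.2 fun i => ?_)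
    simp only [hf]
    fin_cases i
    · simpa using hasDerivAt_const ξ (1 : ℂ)
    · simpa using (hasDerivAt_id ξ).const_mul (Real.sqrt 2 : ℂ)
    · simpa using hasDerivAt_pow 2 ξ
  have hsqrt : (Real.sqrt 2 : ℂ) * (Real.sqrt 2 : ℂ) = 2 := by
    rw [← Complex.ofReal_mul, Real.mul_self_sqrt zero_le_two, Complex.ofReal_ofNat]
  have hnormSq : (Complex.normSq ξ : ℂ) = ξ * (starRingEnd ℂ) ξ :=
    (Complex.mul_conj ξ).symm
  have hne : 1 + ξ * (starRingEnd ℂ) ξ ≠ 0 := by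
    rw [← hnormSq]
    exact_mod_cast (add_pos_of_pos_of_nonneg one_pos (Complex.normSq_nonneg ξ)).ne'
  have hinner : ∑ l, (starRingEnd ℂ) (f ξ l) * deriv f ξ l =
      2 * (starRingEnd ℂ) ξ * (1 + ξ * (starRingEnd ℂ) ξ) := by
    simp only [hderiv, hf, Fin.sum_univ_three, Matrix.cons_val, map_mul, map_pow, map_one,
      Complex.conj_ofReal]
    linear_combination (starRingEnd ℂ) ξ * hsqrt
  have hself : ∑ l, (starRingEnd ℂ) (f ξ l) * f ξ l = (1 + ξ * (starRingEnd ℂ) ξ) ^ 2 := by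
    simp only [hf, Fin.sum_univ_three, Matrix.cons_val, map_mul, map_pow, map_one,
      Complex.conj_ofReal]
    linear_combination (starRingEnd ℂ) ξ * ξ * hsqrt
  have hne_comm : 1 + (starRingEnd ℂ) ξ * ξ ≠ 0 := by rwa [mul_comm]
  rw [hinner, hself, hderiv, hf, hnormSq]
  ext i
  fin_cases i <;>
    simp only [Fin.zero_eta, Fin.mk_one, Fin.reduceFinMk, Pi.sub_apply, Pi.smul_apply,
      smul_eq_mul, Matrix.cons_val] <;>
    field_simp
  · linear_combination (starRingEnd ℂ) ξ * hsqrt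
  · ring
  · linear_combination -ξ * hsqrt
end

section
/- Let f₁ : ℂ → ℂ³ be the map f₁(ξ) = (-√2·conj ξ, 1 - |ξ|², √2·ξ) and P₁(ξ) := 1 - (f₁(ξ) ⊗ f₁(ξ)†)/(f₁(ξ)† · f₁(ξ)). Then the holomorphic quadratic-differential coefficient J vanishes identically: for every ξ ∈ ℂ, (∂̄f₁(ξ))† ⋅ (P₁(ξ).mulVec (∂f₁(ξ))) = 0, where ∂f₁ and ∂̄f₁ are the Wirtinger derivatives of f₁. -/
open Matrix Complex

/-- The mixed Veronese solution f₁(ξ) = (-√2 ξ̄, 1 - |ξ|², √2 ξ). -/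
noncomputable def fmix (ξ : ℂ) : Fin 3 → ℂ :=
  ![-(Real.sqrt 2 : ℂ) * (starRingEnd ℂ) ξ,
    1 - (Complex.normSq ξ : ℂ), (Real.sqrt 2 : ℂ) * ξ]

/-- The projector P₁ = 1 - (f₁ ⊗ f₁†)/(f₁† · f₁). -/
noncomputable def projP1 (ξ : ℂ) : Matrix (Fin 3) (Fin 3) ℂ :=
  1 - Matrix.of (fun j k => fmix ξ j * (starRingEnd ℂ) (fmix ξ k) /
    (∑ l, (starRingEnd ℂ) (fmix ξ l) * fmix ξ l))

theorem hasFDerivAt_fmix (ξ : ℂ) :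
    HasFDerivAt fmix (ContinuousLinearMap.pi
      ![-(Real.sqrt 2 : ℂ) • (conjCLE : ℂ →L[ℝ] ℂ),
        -(ξ • (conjCLE : ℂ →L[ℝ] ℂ) + (starRingEnd ℂ) ξ • ContinuousLinearMap.id ℝ ℂ),
        (Real.sqrt 2 : ℂ) • ContinuousLinearMap.id ℝ ℂ]) ξ := by
  have hid := hasFDerivAt_id (𝕜 := ℝ) ξ
  have hconj : HasFDerivAt (fun z : ℂ => (starRingEnd ℂ) z) (conjCLE : ℂ →L[ℝ] ℂ) ξ :=
    conjCLE.hasFDerivAt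
  rw [hasFDerivAt_pi']
  intro i
  fin_cases i
  · exact hconj.const_mul (-(Real.sqrt 2 : ℂ))
  · have h := (hid.mul hconj).const_sub 1
    convert h using 1
    · ext z
      simp [fmix, normSq_eq_conj_mul_self, mul_comm]
    · rfl
  · exact hid.const_mul (Real.sqrt 2 : ℂ)

theorem wirtingerD_fmix (ξ : ℂ) :
    wirtingerD fmix ξ = ![0, -(starRingEnd ℂ) ξ, (Real.sqrt 2 : ℂ)] := by
  ext i
  rw [wirtingerD, (hasFDerivAt_fmix ξ).fderiv]
  fin_cases i <;> simp <;> ring_nf <;> simp <;> ring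

theorem wirtingerDBar_fmix (ξ : ℂ) :
    wirtingerDBar fmix ξ = ![-(Real.sqrt 2 : ℂ), -ξ, 0] := by
  ext i
  rw [wirtingerDBar, (hasFDerivAt_fmix ξ).fderiv]
  fin_cases i <;> simp <;> ring_nf <;> simp <;> ring

theorem ofReal_sqrt_two_sq : (Real.sqrt 2 : ℂ) ^ 2 = 2 := by
  rw [← ofReal_pow, Real.sq_sqrt zero_le_two, ofReal_ofNat]

theorem sum_conj_fmix_mul_fmix (ξ : ℂ) :
    ∑ l, (starRingEnd ℂ) (fmix ξ l) * fmix ξ l = (1 + (starRingEnd ℂ) ξ * ξ) ^ 2 := by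
  simp only [fmix, Fin.sum_univ_three, normSq_eq_conj_mul_self]
  simp
  linear_combination 2 * ξ * (starRingEnd ℂ) ξ * ofReal_sqrt_two_sq

theorem one_add_conj_mul_ne_zero (ξ : ℂ) : 1 + (starRingEnd ℂ) ξ * ξ ≠ 0 := by
  rw [← normSq_eq_conj_mul_self]
  exact_mod_cast (add_pos_of_pos_of_nonneg one_pos (normSq_nonneg ξ)).ne'

theorem mixed_solution_J_vanishes (ξ : ℂ) :
    (∑ l, (starRingEnd ℂ) (wirtingerDBar fmix ξ l) *
      ((projP1 ξ).mulVec (wirtingerD fmix ξ) l)) = 0 := by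
  have hne := one_add_conj_mul_ne_zero ξ
  have hs := ofReal_sqrt_two_sq
  rw [projP1, sum_conj_fmix_mul_fmix, wirtingerD_fmix, wirtingerDBar_fmix, sub_mulVec, one_mulVec]
  simp only [Pi.sub_apply, mulVec, dotProduct, of_apply, Fin.sum_univ_three, fmix,
    normSq_eq_conj_mul_self]
  simp
  generalize (starRingEnd ℂ) ξ = c at *
  field_simp
  linear_combination -c ^ 2 * ((Real.sqrt 2 : ℂ) ^ 2 + 2 * ξ * c) * hs
end

section
/- Let ψ ∈ ℝ and define w₁, w₂ : ℂ → ℂ by w₁(z) = Complex.exp (z - conj z) and w₂(z) = Complex.exp (Complex.exp (Complex.I * ψ) * z - Complex.exp (-Complex.I * ψ) * conj z). Then the pair (w₁, w₂) satisfies the CP² sigma model equations at every z ∈ ℂ — namely, for {i, j} = {1, 2}: ∂∂̄w_i(z) - (2·conj (w_i z)/A(z))·∂w_i(z)·∂̄w_i(z) - (conj (w_j z)/A(z))·(∂w_i(z)·∂̄w_j(z) + ∂̄w_i(z)·∂w_j(z)) = 0, where A(z) = 1 + |w₁(z)|² + |w₂(z)|² — if and only if Real.cos ψ = 1/2. -/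
open Complex

/-- The CP² sigma-model equation for the component `wi`, with the other
component `wj`. -/
def CP2Eq (wi wj : ℂ → ℂ) (z : ℂ) : Prop :=
  wirtingerD (fun w => wirtingerDBar wi w) z -
    (2 * (starRingEnd ℂ) (wi z) /
        (1 + (Complex.normSq (wi z) : ℂ) + (Complex.normSq (wj z) : ℂ))) *
      (wirtingerD wi z * wirtingerDBar wi z) -
    ((starRingEnd ℂ) (wj z) /
        (1 + (Complex.normSq (wi z) : ℂ) + (Complex.normSq (wj z) : ℂ))) *
      (wirtingerD wi z * wirtingerDBar wj z +
        wirtingerDBar wi z * wirtingerD wj z) = 0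

/-- The exponential of a real-linear form on `ℂ`. -/
noncomputable def expLin (a b : ℂ) (z : ℂ) : ℂ :=
  Complex.exp (a * z + b * (starRingEnd ℂ) z)

lemma hasFDerivAt_expLin (a b z : ℂ) :
    HasFDerivAt (expLin a b)
      (expLin a b z • (a • ContinuousLinearMap.id ℝ ℂ + b • (conjCLE : ℂ →L[ℝ] ℂ))) z := by
  have hid : HasFDerivAt (fun w : ℂ => a * w) (a • ContinuousLinearMap.id ℝ ℂ) z :=
    (hasFDerivAt_id z).const_mul a
  have hconj : HasFDerivAt (fun w : ℂ => b * (starRingEnd ℂ) w)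
      (b • (conjCLE : ℂ →L[ℝ] ℂ)) z :=
    (conjCLE : ℂ →L[ℝ] ℂ).hasFDerivAt.const_mul b
  exact (hid.add hconj).cexp

lemma fderiv_const_mul_expLin (c a b z v : ℂ) :
    fderiv ℝ (fun w => c * expLin a b w) z v =
      c * (expLin a b z * (a * v + b * (starRingEnd ℂ) v)) := by
  rw [((hasFDerivAt_expLin a b z).const_mul c).fderiv]
  simp [mul_add]

lemma wirtingerD_const_mul_expLin (c a b z : ℂ) :
    wirtingerD (fun w => c * expLin a b w) z = c * a * expLin a b z := by
  simp only [wirtingerD, fderiv_const_mul_expLin, smul_eq_mul, map_one, conj_I]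
  linear_combination (-(2 : ℂ)⁻¹ * c * expLin a b z * (a - b)) * I_mul_I

lemma wirtingerDBar_const_mul_expLin (c a b z : ℂ) :
    wirtingerDBar (fun w => c * expLin a b w) z = c * b * expLin a b z := by
  simp only [wirtingerDBar, fderiv_const_mul_expLin, smul_eq_mul, map_one, conj_I]
  linear_combination ((2 : ℂ)⁻¹ * c * expLin a b z * (a - b)) * I_mul_I

lemma wirtingerD_expLin (a b z : ℂ) :
    wirtingerD (expLin a b) z = a * expLin a b z := by
  simpa using wirtingerD_const_mul_expLin 1 a b z

lemma wirtingerDBar_expLin (a b z : ℂ) :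
    wirtingerDBar (expLin a b) z = b * expLin a b z := by
  simpa using wirtingerDBar_const_mul_expLin 1 a b z

lemma normSq_expLin_neg_conj (a z : ℂ) :
    normSq (expLin a (-(starRingEnd ℂ) a) z) = 1 := by
  rw [normSq_eq_norm_sq, expLin, norm_exp]
  simp

/-- For `a` unimodular, the unimodular exponentials with frequencies `a`, `b` solve the
sigma-model equation iff `2 Re (a * conj b) = 1`. -/
lemma cp2Eq_expLin_iff {a b : ℂ} (ha : a * (starRingEnd ℂ) a = 1) (z : ℂ) :
    CP2Eq (expLin a (-(starRingEnd ℂ) a)) (expLin b (-(starRingEnd ℂ) b)) z ↔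
      a * (starRingEnd ℂ) b + (starRingEnd ℂ) a * b = 1 := by
  have hu := mul_conj (expLin a (-(starRingEnd ℂ) a) z)
  have hv := mul_conj (expLin b (-(starRingEnd ℂ) b) z)
  have hne : expLin a (-(starRingEnd ℂ) a) z ≠ 0 := Complex.exp_ne_zero _
  simp only [CP2Eq, wirtingerD_expLin, wirtingerDBar_expLin, wirtingerD_const_mul_expLin,
    normSq_expLin_neg_conj, ofReal_one] at hu hv ⊢
  generalize expLin a (-(starRingEnd ℂ) a) z = u at *
  generalize expLin b (-(starRingEnd ℂ) b) z = v at *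
  trans u / 3 * (a * (starRingEnd ℂ) b + (starRingEnd ℂ) a * b - 1) = 0
  · refine Eq.congr_left ?_
    linear_combination (2 / 3 * a * (starRingEnd ℂ) a * u) * hu +
      (u / 3 * (a * (starRingEnd ℂ) b + (starRingEnd ℂ) a * b)) * hv - u / 3 * ha
  · simp [hne, sub_eq_zero]

theorem meron_solution_iff_cos_psi (ψ : ℝ) (w1 w2 : ℂ → ℂ)
    (hw1 : ∀ z, w1 z = Complex.exp (z - (starRingEnd ℂ) z))
    (hw2 : ∀ z, w2 z = Complex.exp (Complex.exp (Complex.I * ψ) * z -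
      Complex.exp (-Complex.I * ψ) * (starRingEnd ℂ) z)) :
    (∀ z : ℂ, CP2Eq w1 w2 z ∧ CP2Eq w2 w1 z) ↔ Real.cos ψ = 1 / 2 := by
  have hconj : (starRingEnd ℂ) (Complex.exp (I * ψ)) = Complex.exp (-I * ψ) := by
    simp [← exp_conj]
  have hmul : Complex.exp (I * ψ) * (starRingEnd ℂ) (Complex.exp (I * ψ)) = 1 := by
    rw [hconj, ← Complex.exp_add]
    simp
  have h1 : w1 = expLin 1 (-(starRingEnd ℂ) 1) := by
    funext z
    simp [hw1, expLin, sub_eq_add_neg]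
  have h2 : w2 = expLin (Complex.exp (I * ψ)) (-(starRingEnd ℂ) (Complex.exp (I * ψ))) := by
    funext z
    rw [hw2, expLin, hconj, neg_mul, neg_mul, sub_eq_add_neg]
  have hcos : Complex.exp (I * ψ) + Complex.exp (-I * ψ) = ((2 * Real.cos ψ : ℝ) : ℂ) := by
    push_cast
    rw [Complex.two_cos, neg_mul, neg_mul, mul_comm I]
  have hone : (1 : ℂ) * (starRingEnd ℂ) 1 = 1 := by simp
  simp only [h1, h2, cp2Eq_expLin_iff hone, cp2Eq_expLin_iff hmul]
  simp only [hconj, map_one, one_mul, mul_one, add_comm (Complex.exp (-I * ψ)), hcos, and_self,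
    forall_const]
  norm_cast
  constructor <;> intro h <;> linarith
end
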